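/- For every p > 2, the length function L is continuous and strictly decreasing on the interval (0,1]. -/

import Mathlib

open MeasureTheory

/-- `f(t) = t²/2 - tᵖ/p`. -/
noncomputable def f (p t : ℝ) : ℝ := t ^ 2 / 2 - t ^ p / p

lemma continuous_f {p : ℝ} (hp : 2 < p) : Continuous (f p) := by
  unfold f
  have : Continuous fun t : ℝ => t ^ p := Real.continuous_rpow_const (by linarith)
  fun_prop

lemma hasDerivAt_f {p : ℝ} (hp : 2 < p) (t : ℝ) : HasDerivAt (f p) (t - t ^ (p - 1)) t := by
  have h := ((hasDerivAt_pow 2 t).div_const 2).sub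
    ((Real.hasDerivAt_rpow_const (x := t) (p := p) (Or.inr (by linarith))).div_const p)
  have hp0 : p ≠ 0 := by linarith
  refine h.congr_deriv ?_
  simp [mul_div_cancel_left₀ _ hp0]

lemma f_strictMonoOn {p : ℝ} (hp : 2 < p) : StrictMonoOn (f p) (Set.Icc 0 1) := by
  refine strictMonoOn_of_deriv_pos (convex_Icc 0 1) (continuous_f hp).continuousOn ?_
  intro t ht
  rw [interior_Icc] at ht
  rw [(hasDerivAt_f hp t).deriv]
  have := Real.rpow_lt_rpow_of_exponent_gt ht.1 ht.2 (show (1 : ℝ) < p - 1 by linarith)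
  rw [Real.rpow_one] at this
  linarith

lemma f_strictAntiOn {p : ℝ} (hp : 2 < p) : StrictAntiOn (f p) (Set.Ici 1) := by
  refine strictAntiOn_of_deriv_neg (convex_Ici 1) (continuous_f hp).continuousOn ?_
  intro t ht
  rw [interior_Ici] at ht
  rw [(hasDerivAt_f hp t).deriv]
  have := Real.rpow_lt_rpow_of_exponent_lt ht (show (1 : ℝ) < p - 1 by linarith)
  rw [Real.rpow_one] at this
  linarith

lemma f_pos {p z : ℝ} (hp : 2 < p) (hz : z ∈ Set.Ioc (0 : ℝ) 1) : 0 < f p z := by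
  have h := f_strictMonoOn hp (Set.left_mem_Icc.2 zero_le_one) ⟨hz.1.le, hz.2⟩ hz.1
  have h0 : f p 0 = 0 := by simp [f, Real.zero_rpow (show p ≠ 0 by linarith)]
  rwa [h0] at h

/-- A quantitative lower bound for the drop of `f` on `[1, ∞)`. -/
lemma mul_le_f_sub_f {p t w : ℝ} (hp : 2 < p) (ht : 1 ≤ t) (htw : t ≤ w) :
    (p - 2) / 2 * (w - 1) * (w - t) ≤ f p t - f p w := by
  have hd : ∀ x, HasDerivAt (fun x => f p x + (p - 2) / 2 * (x - 1) ^ 2)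
      (x - x ^ (p - 1) + (p - 2) * (x - 1)) x := by
    intro x
    refine ((hasDerivAt_f hp x).add
      ((((hasDerivAt_id x).sub_const 1).pow 2).const_mul ((p - 2) / 2))).congr_deriv ?_
    simp
    ring
  have hanti : AntitoneOn (fun x => f p x + (p - 2) / 2 * (x - 1) ^ 2) (Set.Ici 1) := by
    refine antitoneOn_of_deriv_nonpos (convex_Ici 1)
      (fun x _ => (hd x).continuousAt.continuousWithinAt)
      (fun x _ => (hd x).differentiableAt.differentiableWithinAt) ?_
    intro x hx
    rw [interior_Ici] at hx
    rw [(hd x).deriv]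
    have hx' : (1 : ℝ) < x := hx
    have := one_add_mul_self_le_rpow_one_add (s := x - 1) (by linarith)
      (show 1 ≤ p - 1 by linarith)
    rw [add_sub_cancel] at this
    linarith
  have h := hanti ht (ht.trans htw) htw
  nlinarith [mul_nonneg (mul_nonneg (show 0 ≤ p - 2 by linarith) (sub_nonneg.2 htw))
    (sub_nonneg.2 ht)]

lemma intervalIntegrable_sub_rpow (w a b : ℝ) :
    IntervalIntegrable (fun t : ℝ => (w - t) ^ (-(1 / 2) : ℝ)) volume a b := by
  have h := (intervalIntegral.intervalIntegrable_rpow' (r := -(1 / 2)) (a := w - a) (b := w - b)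
    (by norm_num)).comp_sub_left w
  simpa using h

lemma one_div_sqrt_f_sub_f_le {p t w : ℝ} (hp : 2 < p) (ht : 1 ≤ t) (htw : t < w) :
    1 / √(f p t - f p w) ≤ 1 / √((p - 2) / 2 * (w - 1)) * (w - t) ^ (-(1 / 2) : ℝ) := by
  have h := mul_le_f_sub_f hp ht htw.le
  have hc : 0 < (p - 2) / 2 * (w - 1) := mul_pos (by linarith) (by linarith)
  have hw : 0 < w - t := by linarith
  rw [Real.rpow_neg hw.le, ← Real.sqrt_eq_rpow, ← one_div, div_mul_div_comm, one_mul,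
    ← Real.sqrt_mul hc.le]
  exact one_div_le_one_div_of_le (Real.sqrt_pos.2 (mul_pos hc hw)) (Real.sqrt_le_sqrt h)

lemma intervalIntegrable_one_div_sqrt_f_sub_f {p w : ℝ} (hp : 2 < p) (hw : 1 ≤ w) :
    IntervalIntegrable (fun t => 1 / √(f p t - f p w)) volume 1 w := by
  refine ((intervalIntegrable_sub_rpow w 1 w).const_mul (1 / √((p - 2) / 2 * (w - 1)))).mono_fun
    ?_ ?_
  · have := (continuous_f hp).measurable
    exact Measurable.aestronglyMeasurable (by fun_prop)
  · rw [Set.uIoc_of_le hw]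
    filter_upwards [ae_restrict_mem measurableSet_Ioc,
      ae_restrict_of_ae (Measure.ae_ne volume w)] with t ht htw
    rw [Real.norm_of_nonneg (by positivity)]
    exact (one_div_sqrt_f_sub_f_le hp ht.1.le (lt_of_le_of_ne ht.2 htw)).trans (le_abs_self _)

/-- The part of the length integral over `[1, 1 + A]`, rescaled to `[0, 1]`. -/
noncomputable def rightLength (p A : ℝ) : ℝ :=
  ∫ s in (0 : ℝ)..1, A / √(f p (A * s + 1) - f p (A + 1))

lemma integral_eq_rightLength {p w : ℝ} (hw : 1 < w) :
    ∫ t in (1 : ℝ)..w, 1 / √(f p t - f p w) = rightLength p (w - 1) := by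
  have hA : w - 1 ≠ 0 := by linarith
  have h := intervalIntegral.integral_comp_mul_add (a := 0) (b := 1)
    (fun t => 1 / √(f p t - f p w)) hA 1
  simp only [mul_zero, zero_add, mul_one, sub_add_cancel, smul_eq_mul] at h
  rw [rightLength, sub_add_cancel]
  simp_rw [div_eq_mul_one_div (w - 1)]
  rw [intervalIntegral.integral_const_mul, h]
  field_simp

lemma div_sqrt_f_sub_f_le {p A s : ℝ} (hp : 2 < p) (hA : 0 < A) (hs : 0 ≤ s) (hs1 : s < 1) :
    A / √(f p (A * s + 1) - f p (A + 1)) ≤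
      1 / √((p - 2) / 2) * (1 - s) ^ (-(1 / 2) : ℝ) := by
  have h := one_div_sqrt_f_sub_f_le (t := A * s + 1) (w := A + 1) hp (by nlinarith) (by nlinarith)
  have e : A + 1 - (A * s + 1) = A * (1 - s) := by ring
  have hs' : 0 < 1 - s := by linarith
  have hAs := Real.sq_sqrt hA.le
  have hA0 := Real.sqrt_pos.2 hA
  have hs0 := Real.sqrt_pos.2 hs'
  have hp0 := Real.sqrt_pos.2 (show 0 < (p - 2) / 2 by linarith)
  rw [e, add_sub_cancel_right, Real.rpow_neg (by positivity), ← Real.sqrt_eq_rpow,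
    Real.sqrt_mul (by linarith), Real.sqrt_mul hA.le] at h
  rw [Real.rpow_neg hs'.le, ← Real.sqrt_eq_rpow, div_eq_mul_one_div A]
  refine (mul_le_mul_of_nonneg_left h hA.le).trans_eq ?_
  field_simp
  rw [hAs]

lemma f_sub_f_pos {p A s : ℝ} (hp : 2 < p) (hA : 0 < A) (hs : 0 ≤ s) (hs1 : s < 1) :
    0 < f p (A * s + 1) - f p (A + 1) :=
  sub_pos.2 (f_strictAntiOn hp (show 1 ≤ A * s + 1 by nlinarith) (show 1 ≤ A + 1 by linarith)
    (by nlinarith))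

lemma aestronglyMeasurable_div_sqrt {p : ℝ} (hp : 2 < p) (A : ℝ) (μ : Measure ℝ) :
    AEStronglyMeasurable (fun s => A / √(f p (A * s + 1) - f p (A + 1))) μ := by
  have := (continuous_f hp).measurable
  exact Measurable.aestronglyMeasurable (by fun_prop)

lemma norm_div_sqrt_le {p A : ℝ} (hp : 2 < p) (hA : 0 < A) :
    ∀ᵐ s, s ∈ Set.uIoc (0 : ℝ) 1 → ‖A / √(f p (A * s + 1) - f p (A + 1))‖ ≤
      1 / √((p - 2) / 2) * (1 - s) ^ (-(1 / 2) : ℝ) := by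
  filter_upwards [Measure.ae_ne volume (1 : ℝ)] with s hs1 hs
  rw [Set.uIoc_of_le zero_le_one] at hs
  rw [Real.norm_of_nonneg (by positivity)]
  exact div_sqrt_f_sub_f_le hp hA hs.1.le (lt_of_le_of_ne hs.2 hs1)

lemma intervalIntegrable_div_sqrt {p A : ℝ} (hp : 2 < p) (hA : 0 < A) :
    IntervalIntegrable (fun s => A / √(f p (A * s + 1) - f p (A + 1))) volume 0 1 :=
  ((intervalIntegrable_sub_rpow 1 0 1).const_mul (1 / √((p - 2) / 2))).mono_fun'
    (aestronglyMeasurable_div_sqrt hp A _)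
    ((ae_restrict_iff' measurableSet_uIoc).2 (norm_div_sqrt_le hp hA))

lemma continuousAt_rightLength {p A : ℝ} (hp : 2 < p) (hA : 0 < A) :
    ContinuousAt (rightLength p) A := by
  refine intervalIntegral.continuousAt_of_dominated_interval
    (bound := fun s => 1 / √((p - 2) / 2) * (1 - s) ^ (-(1 / 2) : ℝ))
    (.of_forall fun B => aestronglyMeasurable_div_sqrt hp B _) ?_
    ((intervalIntegrable_sub_rpow 1 0 1).const_mul _) ?_
  · filter_upwards [lt_mem_nhds hA] with B hB using norm_div_sqrt_le hp hB
  · filter_upwards [Measure.ae_ne volume (1 : ℝ)] with s hs1 hs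
    rw [Set.uIoc_of_le zero_le_one] at hs
    have hpos := f_sub_f_pos hp hA hs.1.le (lt_of_le_of_ne hs.2 hs1)
    have hf := continuous_f hp
    exact ContinuousAt.div continuousAt_id (by fun_prop) (Real.sqrt_pos.2 hpos).ne'

/-- `x ↦ ((1 + x) ^ (p - 1) - (1 + x)) / x` is strictly increasing on `(0, ∞)`. -/
lemma mul_rpow_sub_lt {p x y : ℝ} (hp : 2 < p) (hx : 0 < x) (hxy : x < y) :
    y * ((x + 1) ^ (p - 1) - (x + 1)) < x * ((y + 1) ^ (p - 1) - (y + 1)) := by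
  have hy : 0 < y := hx.trans hxy
  have h := (strictConvexOn_rpow (show 1 < p - 1 by linarith)).2
    (show (0 : ℝ) ≤ 1 by norm_num) (show 0 ≤ y + 1 by linarith) (by linarith)
    (show 0 < 1 - x / y by rw [sub_pos, div_lt_one hy]; exact hxy) (div_pos hx hy) (by ring)
  simp only [smul_eq_mul, Real.one_rpow, mul_one] at h
  have e : 1 - x / y + x / y * (y + 1) = x + 1 := by field_simp; ring
  rw [e] at h
  have h' := mul_lt_mul_of_pos_left h hy
  have e' : y * (1 - x / y + x / y * (y + 1) ^ (p - 1)) = y - x + x * (y + 1) ^ (p - 1) := by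
    field_simp
  rw [e'] at h'
  linarith

lemma sq_mul_f_sub_f_lt {p A B s : ℝ} (hp : 2 < p) (hA : 0 < A) (hAB : A < B) (hs : 0 ≤ s)
    (hs1 : s < 1) :
    B ^ 2 * (f p (A * s + 1) - f p (A + 1)) < A ^ 2 * (f p (B * s + 1) - f p (B + 1)) := by
  have hd1 : ∀ C x, HasDerivAt (fun x => f p (C * x + 1))
      ((C * x + 1 - (C * x + 1) ^ (p - 1)) * C) x := by
    intro C x
    have h1 : HasDerivAt (fun x : ℝ => C * x + 1) C x := by
      simpa using ((hasDerivAt_id x).const_mul C).add_const 1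
    exact (hasDerivAt_f hp (C * x + 1)).comp x h1
  have hd : ∀ x, HasDerivAt (fun x => A ^ 2 * f p (B * x + 1) - B ^ 2 * f p (A * x + 1))
      (A ^ 2 * ((B * x + 1 - (B * x + 1) ^ (p - 1)) * B) -
        B ^ 2 * ((A * x + 1 - (A * x + 1) ^ (p - 1)) * A)) x :=
    fun x => ((hd1 B x).const_mul _).sub ((hd1 A x).const_mul _)
  have hanti : StrictAntiOn (fun x => A ^ 2 * f p (B * x + 1) - B ^ 2 * f p (A * x + 1))
      (Set.Icc 0 1) := by
    refine strictAntiOn_of_deriv_neg (convex_Icc 0 1)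
      (fun x _ => (hd x).continuousAt.continuousWithinAt) ?_
    intro x hx
    rw [interior_Icc] at hx
    rw [(hd x).deriv]
    have h := mul_rpow_sub_lt hp (mul_pos hA hx.1) (mul_lt_mul_of_pos_right hAB hx.1)
    have h2 : B * ((A * x + 1) ^ (p - 1) - (A * x + 1)) <
        A * ((B * x + 1) ^ (p - 1) - (B * x + 1)) := by
      refine lt_of_mul_lt_mul_left ?_ hx.1.le
      linarith
    have := mul_lt_mul_of_pos_left h2 (mul_pos hA (hA.trans hAB))
    linarith
  have h := hanti ⟨hs, hs1.le⟩ (Set.right_mem_Icc.2 zero_le_one) hs1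
  simp only [mul_one] at h
  linarith

lemma rightLength_strictAntiOn {p : ℝ} (hp : 2 < p) :
    StrictAntiOn (rightLength p) (Set.Ioi 0) := by
  intro A hA B hB hAB
  have hA' : 0 < A := hA
  have hB' : 0 < B := hB
  rw [← sub_pos, rightLength, rightLength,
    ← intervalIntegral.integral_sub (intervalIntegrable_div_sqrt hp hA)
      (intervalIntegrable_div_sqrt hp hB)]
  refine intervalIntegral.intervalIntegral_pos_of_pos_on
    ((intervalIntegrable_div_sqrt hp hA).sub (intervalIntegrable_div_sqrt hp hB)) ?_ zero_lt_one
  intro s hs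
  have hDA := f_sub_f_pos hp hA hs.1.le hs.2
  have hDB := f_sub_f_pos hp hB hs.1.le hs.2
  rw [sub_pos, div_lt_div_iff₀ (Real.sqrt_pos.2 hDB) (Real.sqrt_pos.2 hDA)]
  refine lt_of_pow_lt_pow_left₀ 2 (by positivity) ?_
  rw [mul_pow, mul_pow, Real.sq_sqrt hDA.le, Real.sq_sqrt hDB.le]
  exact sq_mul_f_sub_f_lt hp hA hAB hs.1.le hs.2

/-- The part of the length integral over `[z, 1]`. -/
noncomputable def leftLength (p z : ℝ) : ℝ :=
  ∫ t in z..1, 1 / √(f p t + 3 * f p z)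

lemma f_add_pos {p z t : ℝ} (hp : 2 < p) (hz : 0 < z) (ht : t ∈ Set.Icc z 1) :
    0 < f p t + 3 * f p z := by
  linarith [f_pos hp ⟨hz.trans_le ht.1, ht.2⟩, f_pos hp ⟨hz, ht.1.trans ht.2⟩]

lemma intervalIntegrable_left {p y z : ℝ} (hp : 2 < p) (hy : 0 < y) (hyz : y ≤ z) (hz : z ≤ 1) :
    IntervalIntegrable (fun t => 1 / √(f p t + 3 * f p y)) volume z 1 := by
  have hf := continuous_f hp
  refine ContinuousOn.intervalIntegrable_of_Icc hz
    (continuousOn_const.div (by fun_prop) fun t ht => ?_)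
  exact (Real.sqrt_pos.2 (f_add_pos hp hy ⟨hyz.trans ht.1, ht.2⟩)).ne'

lemma leftLength_antitoneOn {p : ℝ} (hp : 2 < p) :
    AntitoneOn (leftLength p) (Set.Ioc 0 1) := by
  intro y hy z hz hyz
  calc leftLength p z ≤ ∫ t in z..1, 1 / √(f p t + 3 * f p y) := by
        refine intervalIntegral.integral_mono_on hz.2 (intervalIntegrable_left hp hz.1 le_rfl hz.2)
          (intervalIntegrable_left hp hy.1 hyz hz.2) fun t ht => ?_
        have := (f_strictMonoOn hp).monotoneOn ⟨hy.1.le, hy.2⟩ ⟨hz.1.le, hz.2⟩ hyz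
        exact one_div_le_one_div_of_le
          (Real.sqrt_pos.2 (f_add_pos hp hy.1 ⟨hyz.trans ht.1, ht.2⟩))
          (Real.sqrt_le_sqrt (by linarith))
    _ ≤ leftLength p y :=
        intervalIntegral.integral_mono_interval hyz hz.2 le_rfl
          (.of_forall fun t => by positivity) (intervalIntegrable_left hp hy.1 le_rfl hy.2)

lemma continuousOn_leftLength {p : ℝ} (hp : 2 < p) :
    ContinuousOn (leftLength p) (Set.Ioc 0 1) := by
  intro z hz
  have hf := continuous_f hp
  have ha : z / 2 ∈ Set.Ioc (0 : ℝ) 1 := ⟨by linarith [hz.1], by linarith [hz.1, hz.2]⟩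
  have hfa := f_pos hp ha
  set a := z / 2 with ha_def
  have hF : Continuous (Function.uncurry fun y t : ℝ => 1 / √(max (f p t + 3 * f p y) (f p a))) :=
    Continuous.div continuous_const (by fun_prop)
      fun q => (Real.sqrt_pos.2 (lt_max_of_lt_right hfa)).ne'
  have hc : Continuous fun y : ℝ => -∫ t in (1 : ℝ)..y, 1 / √(max (f p t + 3 * f p y) (f p a)) :=
    (intervalIntegral.continuous_parametric_intervalIntegral_of_continuous hF continuous_id).neg
  have heq : ∀ y ∈ Set.Icc a 1, leftLength p y =
      -∫ t in (1 : ℝ)..y, 1 / √(max (f p t + 3 * f p y) (f p a)) := by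
    intro y hy
    rw [leftLength, ← intervalIntegral.integral_symm]
    refine intervalIntegral.integral_congr fun t ht => ?_
    rw [Set.uIcc_of_le hy.2] at ht
    have h1 := (f_strictMonoOn hp).monotoneOn ⟨ha.1.le, ha.2⟩ ⟨ha.1.le.trans hy.1, hy.2⟩ hy.1
    have h2 := f_pos hp ⟨ha.1.trans_le (hy.1.trans ht.1), ht.2⟩
    rw [max_eq_left (by linarith)]
  refine hc.continuousWithinAt.congr_of_eventuallyEq ?_ (heq z ⟨by linarith [hz.1], hz.2⟩)
  filter_upwards [self_mem_nhdsWithin,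
    mem_nhdsWithin_of_mem_nhds (lt_mem_nhds (show a < z by linarith [hz.1]))] with y hy hay
  exact heq y ⟨hay.le, hy.2⟩

lemma one_lt_of_f_eq {p z w : ℝ} (hp : 2 < p) (hz : z ∈ Set.Ioc (0 : ℝ) 1) (hw : 1 ≤ w)
    (hfw : f p w = -3 * f p z) : 1 < w := by
  refine lt_of_le_of_ne hw ?_
  rintro rfl
  linarith [f_pos hp hz, f_pos hp (Set.right_mem_Ioc.2 (zero_lt_one' ℝ))]

lemma integral_eq_leftLength_add_rightLength {p z w : ℝ} (hp : 2 < p)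
    (hz : z ∈ Set.Ioc (0 : ℝ) 1) (hw : 1 ≤ w) (hfw : f p w = -3 * f p z) :
    ∫ t in z..w, 1 / √(f p t + 3 * f p z) = leftLength p z + rightLength p (w - 1) := by
  have e : ∀ t, f p t + 3 * f p z = f p t - f p w := fun t => by rw [hfw]; ring
  have hr := intervalIntegrable_one_div_sqrt_f_sub_f hp hw
  rw [← integral_eq_rightLength (one_lt_of_f_eq hp hz hw hfw), leftLength]
  simp_rw [← e] at hr ⊢
  exact (intervalIntegral.integral_add_adjacent_intervals
    (intervalIntegrable_left hp hz.1 le_rfl hz.2) hr).symm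

lemma continuousOn_of_f_eq {p : ℝ} (hp : 2 < p) {w : ℝ → ℝ} {S : Set ℝ}
    (hw : ∀ z ∈ S, 1 ≤ w z ∧ f p (w z) = -3 * f p z) : ContinuousOn w S := by
  intro z hz
  obtain ⟨h1, h2⟩ := hw z hz
  have hc : ContinuousWithinAt (fun y => -3 * f p y) S z :=
    ((continuous_f hp).const_mul _ |>.continuousWithinAt)
  refine tendsto_order.2 ⟨fun a ha => ?_, fun b hb => ?_⟩
  · rcases lt_or_ge a 1 with ha1 | ha1
    · filter_upwards [self_mem_nhdsWithin] with y hy using ha1.trans_le (hw y hy).1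
    · have hlt := f_strictAntiOn hp ha1 h1 ha
      rw [h2] at hlt
      filter_upwards [self_mem_nhdsWithin, hc.eventually (gt_mem_nhds hlt)] with y hy hya
      rw [← (hw y hy).2] at hya
      exact ((f_strictAntiOn hp).lt_iff_gt (hw y hy).1 ha1).1 hya
  · have hb1 : 1 ≤ b := h1.trans hb.le
    have hlt := f_strictAntiOn hp h1 hb1 hb
    rw [h2] at hlt
    filter_upwards [self_mem_nhdsWithin, hc.eventually (lt_mem_nhds hlt)] with y hy hyb
    rw [← (hw y hy).2] at hyb
    exact ((f_strictAntiOn hp).lt_iff_gt hb1 (hw y hy).1).1 hyb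

/-- for every `p > 2`, the length function
`L(z) = (1/√2) ∫_z^{w(z)} dt/√(f(t)+3f(z))`, where `w(z) ∈ [1,∞)` is the unique point with
`f(w(z)) = -3 f(z)`, is continuous and strictly decreasing on `(0,1]`. -/
theorem stmt_5 (p : ℝ) (hp : 2 < p) (w : ℝ → ℝ)
    (hw : ∀ z ∈ Set.Ioc (0 : ℝ) ((p / 2) ^ (1 / (p - 2))),
      1 ≤ w z ∧ f p (w z) = -3 * f p z)
    (L : ℝ → ℝ)
    (hL : ∀ z ∈ Set.Ioc (0 : ℝ) ((p / 2) ^ (1 / (p - 2))),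
      L z = (1 / Real.sqrt 2) * ∫ t in z..(w z), 1 / Real.sqrt (f p t + 3 * f p z)) :
    ContinuousOn L (Set.Ioc 0 1) ∧ StrictAntiOn L (Set.Ioc 0 1) := by
  have hsub : Set.Ioc (0 : ℝ) 1 ⊆ Set.Ioc (0 : ℝ) ((p / 2) ^ (1 / (p - 2))) := fun z hz =>
    ⟨hz.1, hz.2.trans (Real.one_le_rpow (by linarith) (one_div_nonneg.2 (by linarith)))⟩
  have hw' : ∀ z ∈ Set.Ioc (0 : ℝ) 1, 1 ≤ w z ∧ f p (w z) = -3 * f p z :=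
    fun z hz => hw z (hsub hz)
  have hlt : ∀ z ∈ Set.Ioc (0 : ℝ) 1, 0 < w z - 1 := fun z hz =>
    sub_pos.2 (one_lt_of_f_eq hp hz (hw' z hz).1 (hw' z hz).2)
  have hL' : ∀ z ∈ Set.Ioc (0 : ℝ) 1,
      L z = (1 / √2) * (leftLength p z + rightLength p (w z - 1)) := fun z hz => by
    rw [hL z (hsub hz),
      integral_eq_leftLength_add_rightLength hp hz (hw' z hz).1 (hw' z hz).2]
  constructor
  · refine ContinuousOn.congr (continuousOn_const.mul ((continuousOn_leftLength hp).add ?_)) hL'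
    have hcw : ContinuousOn (fun z => w z - 1) (Set.Ioc 0 1) :=
      (continuousOn_of_f_eq hp hw').sub continuousOn_const
    exact fun z hz => (continuousAt_rightLength hp (hlt z hz)).comp_continuousWithinAt
      (f := fun z => w z - 1) (hcw z hz)
  · intro y hy z hz hyz
    rw [hL' y hy, hL' z hz]
    have hfyz := f_strictMonoOn hp ⟨hy.1.le, hy.2⟩ ⟨hz.1.le, hz.2⟩ hyz
    have hwyz : w y < w z := by
      refine ((f_strictAntiOn hp).lt_iff_gt (hw' z hz).1 (hw' y hy).1).1 ?_
      rw [(hw' y hy).2, (hw' z hz).2]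
      linarith
    exact mul_lt_mul_of_pos_left (add_lt_add_of_le_of_lt (leftLength_antitoneOn hp hy hz hyz.le)
      (rightLength_strictAntiOn hp (hlt y hy) (hlt z hz) (by linarith))) (by positivity)
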